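/- arXiv:1202.6669 — 2 statements merged into one kernel-verified Lean document; each statement's English description precedes it below -/
import Mathlib

section
/- Fix reals P_T > 0, N > 0, J_Max > 0 and define R(J) = (1/2)·log(1 + P_T/(N + J)) for J ∈ [0, J_Max]. Then the function F(J) = (J_Max/(J_Max − J)) · (1 − R(J_Max)/R(J)) is strictly decreasing on the interval [0, J_Max). -/
lemma aux_hL (P x : ℝ) (hP : 0 < P) (hx : 0 < x) :
    HasDerivAt (fun x : ℝ => Real.log (1 + P / x)) (-P / (x * (x + P))) x := by
  have h1 : HasDerivAt (fun x : ℝ => 1 + P / x) (-P / x ^ 2) x := by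
    have := ((hasDerivAt_inv hx.ne').const_mul P).const_add 1
    refine HasDerivAt.congr_deriv this ?_
    ring
  have hpos : 0 < 1 + P / x := by positivity
  refine HasDerivAt.congr_deriv (h1.log hpos.ne') ?_
  have : x + P ≠ 0 := by positivity
  field_simp

lemma aux_pos (P x : ℝ) (hP : 0 < P) (hx : 0 < x) : 0 < Real.log (1 + P / x) := by
  apply Real.log_pos
  have : 0 < P / x := by positivity
  linarith

lemma aux_mono (P : ℝ) (hP : 0 < P) :
    StrictMonoOn (fun x : ℝ => x * (x + P) * Real.log (1 + P / x) ^ 2) (Set.Ioi 0) := by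
  have key : ∀ x : ℝ, 0 < x → HasDerivAt (fun x : ℝ => x * (x + P) * Real.log (1 + P / x) ^ 2)
      (Real.log (1 + P / x) * ((2 * x + P) * Real.log (1 + P / x) - 2 * P)) x := by
    intro x hx
    have h := ((hasDerivAt_id' x).mul ((hasDerivAt_id' x).add_const P)).mul
      ((aux_hL P x hP hx).pow 2)
    refine HasDerivAt.congr_deriv h ?_
    have : x + P ≠ 0 := by positivity
    simp
    field_simp
    ring
  apply strictMonoOn_of_deriv_pos (convex_Ioi 0)
  · intro x hx
    exact (key x hx).continuousAt.continuousWithinAt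
  · intro x hx
    rw [interior_Ioi] at hx
    have hx : 0 < x := hx
    rw [(key x hx).deriv]
    apply mul_pos (aux_pos P x hP hx)
    have h := Real.lt_log_one_add_of_pos (x := P / x) (by positivity)
    have e : 2 * (P / x) / (P / x + 2) = 2 * P / (2 * x + P) := by
      field_simp
      ring
    rw [e, div_lt_iff₀ (by positivity)] at h
    linarith

lemma aux_conc (P : ℝ) (hP : 0 < P) :
    StrictConcaveOn ℝ (Set.Ioi 0) (fun x : ℝ => (Real.log (1 + P / x))⁻¹) := by
  have key : ∀ x : ℝ, 0 < x → HasDerivAt (fun x : ℝ => (Real.log (1 + P / x))⁻¹)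
      (P / (x * (x + P) * Real.log (1 + P / x) ^ 2)) x := by
    intro x hx
    have h0 := aux_pos P x hP hx
    refine HasDerivAt.congr_deriv ((aux_hL P x hP hx).fun_inv h0.ne') ?_
    rw [neg_div, neg_div, neg_div, neg_neg, div_div]
  apply StrictAntiOn.strictConcaveOn_of_deriv (convex_Ioi 0)
  · intro x hx
    exact (key x hx).continuousAt.continuousWithinAt
  · rw [interior_Ioi]
    intro x hx y hy hxy
    rw [(key x hx).deriv, (key y hy).deriv]
    have hx' : 0 < x := hx
    have h0 := aux_pos P x hP hx
    exact div_lt_div_of_pos_left hP (by positivity) (aux_mono P hP hx hy hxy)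

theorem F_strictAntiOn
    (P_T N J_Max : ℝ) (hP : 0 < P_T) (hN : 0 < N) (hJ : 0 < J_Max) :
    StrictAntiOn
      (fun J : ℝ =>
        (J_Max / (J_Max - J)) *
          (1 - ((1 / 2) * Real.log (1 + P_T / (N + J_Max))) /
               ((1 / 2) * Real.log (1 + P_T / (N + J)))))
      (Set.Ico (0 : ℝ) J_Max) := by
  have hM := aux_pos P_T (N + J_Max) hP (by positivity)
  have key : ∀ J ∈ Set.Ico (0 : ℝ) J_Max, (J_Max / (J_Max - J)) *
          (1 - ((1 / 2) * Real.log (1 + P_T / (N + J_Max))) /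
               ((1 / 2) * Real.log (1 + P_T / (N + J)))) =
      (J_Max * Real.log (1 + P_T / (N + J_Max))) *
        (((Real.log (1 + P_T / (N + J)))⁻¹ - (Real.log (1 + P_T / (N + J_Max)))⁻¹) /
          ((N + J) - (N + J_Max))) := by
    intro J hJ'
    have hL := aux_pos P_T (N + J) hP (by linarith [hJ'.1])
    have e : (N + J) - (N + J_Max) = -(J_Max - J) := by ring
    have h1 : J_Max - J ≠ 0 := (sub_pos.2 hJ'.2).ne'
    rw [e]
    generalize Real.log (1 + P_T / (N + J)) = a at *
    generalize Real.log (1 + P_T / (N + J_Max)) = b at *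
    generalize J_Max - J = d at *
    field_simp
    ring
  intro x hx y hy hxy
  simp only
  rw [key x hx, key y hy]
  apply mul_lt_mul_of_pos_left _ (by positivity)
  exact (aux_conc P_T hP).secant_strict_mono (a := N + J_Max) (x := N + x) (y := N + y)
    (Set.mem_Ioi.2 (by positivity)) (Set.mem_Ioi.2 (by linarith [hx.1]))
    (Set.mem_Ioi.2 (by linarith [hy.1])) (by simpa using hx.2.ne)
    (by simpa using hy.2.ne) (by linarith)
end

section
/- Fix reals P_T > 0, N > 0, J_Max > 0 and an integer N_T ≥ 1. Define α⁻¹ = Σ_{i=0}^{N_T−1} (R_i)⁻¹ and J_TH = (1 − (1/N_T)·α⁻¹·R_{N_T})·J_Max. Then for every J_Ave with J_TH ≤ J_Ave ≤ J_Max, the value of the constrained zero-sum game equals R_{N_T}: sup over mixed strategies x of (inf over y ∈ Y_LE(J_Ave) of xᵀ C y) = inf over y ∈ Y_LE(J_Ave) of (sup over mixed strategies x of xᵀ C y) = R_{N_T} = (1/2)·log(1 + P_T/(N + J_Max)). -/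
open BigOperators

/-- Rate `R_i = (1/2)·log(1 + P_T/(N + (i/N_T)·J_Max))`. -/
noncomputable def rate (P_T N J_Max : ℝ) (N_T i : ℕ) : ℝ :=
  (1 / 2) * Real.log (1 + P_T / (N + ((i : ℝ) / (N_T : ℝ)) * J_Max))

/-- Payoff matrix `C_{i,j} = R_i` if `j ≤ i`, else `0`. -/
noncomputable def payC (P_T N J_Max : ℝ) (N_T : ℕ) (i j : Fin (N_T + 1)) : ℝ :=
  if (j : ℕ) ≤ (i : ℕ) then rate P_T N J_Max N_T (i : ℕ) else 0

/-- Jamming power level `J_j = (j/N_T)·J_Max`. -/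
noncomputable def jamPow (J_Max : ℝ) (N_T j : ℕ) : ℝ := ((j : ℝ) / (N_T : ℝ)) * J_Max

/-- The simplex of mixed strategies. -/
def mixedSet (n : ℕ) : Set (Fin n → ℝ) := {x | (∀ i, 0 ≤ x i) ∧ ∑ i, x i = 1}

/-- Jammer's average-power constrained mixed strategy set `Y_LE(J_Ave)`. -/
noncomputable def YLE (J_Max : ℝ) (N_T : ℕ) (J_Ave : ℝ) : Set (Fin (N_T + 1) → ℝ) :=
  {y | y ∈ mixedSet (N_T + 1) ∧ ∑ j : Fin (N_T + 1), jamPow J_Max N_T (j : ℕ) * y j ≤ J_Ave}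

/-- Expected payoff `xᵀ C y`. -/
noncomputable def payoff (P_T N J_Max : ℝ) (N_T : ℕ) (x y : Fin (N_T + 1) → ℝ) : ℝ :=
  ∑ i, ∑ j, x i * payC P_T N J_Max N_T i j * y j

theorem gvaux_rate_pos (P_T N J_Max : ℝ) (hP : 0 < P_T) (hN : 0 < N) (hJ : 0 < J_Max)
    (N_T i : ℕ) : 0 < rate P_T N J_Max N_T i := by
  unfold rate
  have h : 0 < P_T / (N + ((i : ℝ) / (N_T : ℝ)) * J_Max) := by positivity
  have := Real.log_pos (show 1 < 1 + P_T / (N + ((i : ℝ) / (N_T : ℝ)) * J_Max) by linarith)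
  positivity

theorem gvaux_rate_anti (P_T N J_Max : ℝ) (hP : 0 < P_T) (hN : 0 < N) (hJ : 0 < J_Max)
    (N_T i : ℕ) : rate P_T N J_Max N_T (i + 1) ≤ rate P_T N J_Max N_T i := by
  unfold rate
  gcongr
  linarith

noncomputable def gvauxZ (r : ℕ → ℝ) (c : ℝ) : ℕ → ℝ
  | 0 => c / r 0
  | (i + 1) => c / r (i + 1) - c / r i

theorem gvaux_sum (r : ℕ → ℝ) (c : ℝ) (n : ℕ) :
    ∑ j ∈ Finset.range (n + 1), gvauxZ r c j = c / r n := by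
  induction n with
  | zero => simp [gvauxZ]
  | succ n ih => rw [Finset.sum_range_succ, ih, gvauxZ]; ring

theorem gvaux_mean (r : ℕ → ℝ) (c : ℝ) (n : ℕ) :
    ∑ j ∈ Finset.range (n + 1), (j : ℝ) * gvauxZ r c j
      = n * (c / r n) - c * ∑ i ∈ Finset.range n, (r i)⁻¹ := by
  induction n with
  | zero => simp
  | succ n ih =>
    rw [Finset.sum_range_succ, ih, gvauxZ, Finset.sum_range_succ]
    push_cast
    ring

theorem game_value_powerful_jammer
    (P_T N J_Max : ℝ) (hP : 0 < P_T) (hN : 0 < N) (hJ : 0 < J_Max)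
    (N_T : ℕ) (hNT : 1 ≤ N_T) (J_Ave : ℝ)
    (hTH : (1 - (1 / (N_T : ℝ)) * (∑ i ∈ Finset.range N_T, (rate P_T N J_Max N_T i)⁻¹) *
        rate P_T N J_Max N_T N_T) * J_Max ≤ J_Ave)
    (hJA : J_Ave ≤ J_Max) :
    (⨆ x : mixedSet (N_T + 1), ⨅ y : YLE J_Max N_T J_Ave,
        payoff P_T N J_Max N_T (x : Fin (N_T + 1) → ℝ) (y : Fin (N_T + 1) → ℝ)) =
      rate P_T N J_Max N_T N_T ∧
    (⨅ y : YLE J_Max N_T J_Ave, ⨆ x : mixedSet (N_T + 1),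
        payoff P_T N J_Max N_T (x : Fin (N_T + 1) → ℝ) (y : Fin (N_T + 1) → ℝ)) =
      rate P_T N J_Max N_T N_T ∧
    rate P_T N J_Max N_T N_T = (1 / 2) * Real.log (1 + P_T / (N + J_Max)) := by
  set R := rate P_T N J_Max N_T N_T with hR
  have hpos : ∀ i, 0 < rate P_T N J_Max N_T i := gvaux_rate_pos P_T N J_Max hP hN hJ N_T
  have hNpos : (0 : ℝ) < N_T := by exact_mod_cast hNT
  have hRpos : 0 < R := hpos N_T
  set z := gvauxZ (rate P_T N J_Max N_T) R with hz
  have hz0 : ∀ j, 0 ≤ z j := by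
    intro j
    cases j with
    | zero => exact div_nonneg hRpos.le (hpos 0).le
    | succ j =>
      have := div_le_div_of_nonneg_left hRpos.le (hpos (j + 1))
        (gvaux_rate_anti P_T N J_Max hP hN hJ N_T j)
      simp only [hz, gvauxZ]
      linarith
  let ys : Fin (N_T + 1) → ℝ := fun j => z j
  have hys : ys ∈ YLE J_Max N_T J_Ave := by
    refine ⟨⟨fun i => hz0 i, ?_⟩, ?_⟩
    · rw [Fin.sum_univ_eq_sum_range (fun j => z j) (N_T + 1), hz, gvaux_sum]
      exact div_self hRpos.ne'
    · rw [Fin.sum_univ_eq_sum_range (fun j => jamPow J_Max N_T j * z j) (N_T + 1)]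
      have h1 : ∑ j ∈ Finset.range (N_T + 1), jamPow J_Max N_T j * z j
          = (J_Max / N_T) * ∑ j ∈ Finset.range (N_T + 1), (j : ℝ) * z j := by
        rw [Finset.mul_sum]
        refine Finset.sum_congr rfl fun j _ => ?_
        unfold jamPow
        ring
      rw [h1, hz, gvaux_mean, ← hR, div_self hRpos.ne']
      refine le_trans (le_of_eq ?_) hTH
      field_simp
  have hpys : ∀ x ∈ mixedSet (N_T + 1), payoff P_T N J_Max N_T x ys = R := by
    intro x hx
    unfold payoff
    have h1 : ∀ i : Fin (N_T + 1), ∑ j, x i * payC P_T N J_Max N_T i j * ys j = x i * R := by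
      intro i
      have h2 : ∑ j : Fin (N_T + 1), payC P_T N J_Max N_T i j * ys j = R := by
        unfold payC
        rw [Fin.sum_univ_eq_sum_range (fun j => (if j ≤ (i : ℕ) then
          rate P_T N J_Max N_T (i : ℕ) else 0) * z j) (N_T + 1)]
        have h3 : ∑ j ∈ Finset.range (i + 1), (if j ≤ (i : ℕ) then
          rate P_T N J_Max N_T (i : ℕ) else 0) * z j = R := by
          have h4 : ∑ j ∈ Finset.range (i + 1), (if j ≤ (i : ℕ) then
            rate P_T N J_Max N_T (i : ℕ) else 0) * z j =
            rate P_T N J_Max N_T i * ∑ j ∈ Finset.range (i + 1), z j := by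
            rw [Finset.mul_sum]
            refine Finset.sum_congr rfl fun j hj => ?_
            rw [if_pos (by have := Finset.mem_range.1 hj; omega)]
          rw [h4, hz, gvaux_sum]
          exact mul_div_cancel₀ _ (hpos i).ne'
        rw [← h3]
        symm
        refine Finset.sum_subset (Finset.range_mono (by omega)) fun j _ hj => ?_
        rw [if_neg (by have := mt Finset.mem_range.2 hj; omega), zero_mul]
      simp_rw [mul_assoc]
      rw [← Finset.mul_sum, h2]
    simp_rw [h1]
    rw [← Finset.sum_mul, hx.2, one_mul]
  let xs : Fin (N_T + 1) → ℝ := Pi.single (Fin.last N_T) 1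
  have hxs : xs ∈ mixedSet (N_T + 1) := by
    refine ⟨fun i => ?_, by simp [xs]⟩
    simp only [xs, Pi.single_apply]
    split_ifs <;> norm_num
  have hpxs : ∀ y ∈ mixedSet (N_T + 1), payoff P_T N J_Max N_T xs y = R := by
    intro y hy
    unfold payoff
    rw [Finset.sum_eq_single (Fin.last N_T)]
    · have : ∀ j : Fin (N_T + 1),
          xs (Fin.last N_T) * payC P_T N J_Max N_T (Fin.last N_T) j * y j = R * y j := by
        intro j
        have : (j : ℕ) ≤ N_T := by omega
        simp [xs, payC, this, hR]
      simp_rw [this]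
      rw [← Finset.mul_sum, hy.2, mul_one]
    · intro i _ hi
      simp [xs, hi]
    · simp
  have hC0 : ∀ i j, 0 ≤ payC P_T N J_Max N_T i j := by
    intro i j
    unfold payC
    split_ifs
    · exact (hpos _).le
    · exact le_rfl
  have hge : ∀ x ∈ mixedSet (N_T + 1), ∀ y ∈ mixedSet (N_T + 1),
      0 ≤ payoff P_T N J_Max N_T x y := by
    intro x hx y hy
    exact Finset.sum_nonneg fun i _ => Finset.sum_nonneg fun j _ =>
      mul_nonneg (mul_nonneg (hx.1 i) (hC0 i j)) (hy.1 j)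
  have hle1 : ∀ x ∈ mixedSet (N_T + 1), ∀ i, x i ≤ 1 := by
    intro x hx i
    rw [← hx.2]
    exact Finset.single_le_sum (fun j _ => hx.1 j) (Finset.mem_univ i)
  have hle : ∀ x ∈ mixedSet (N_T + 1), ∀ y ∈ mixedSet (N_T + 1),
      payoff P_T N J_Max N_T x y ≤ ∑ i, ∑ j, payC P_T N J_Max N_T i j := by
    intro x hx y hy
    refine Finset.sum_le_sum fun i _ => Finset.sum_le_sum fun j _ => ?_
    have h1 := mul_le_of_le_one_left (hC0 i j) (hle1 x hx i)
    exact (mul_le_of_le_one_right (mul_nonneg (hx.1 i) (hC0 i j)) (hle1 y hy j)).trans h1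
  have : Nonempty (mixedSet (N_T + 1)) := ⟨⟨xs, hxs⟩⟩
  have : Nonempty (YLE J_Max N_T J_Ave) := ⟨⟨ys, hys⟩⟩
  have hinf : ∀ x : mixedSet (N_T + 1), (⨅ y : YLE J_Max N_T J_Ave,
      payoff P_T N J_Max N_T (x : Fin (N_T + 1) → ℝ) (y : Fin (N_T + 1) → ℝ)) ≤ R := by
    intro x
    refine (ciInf_le ⟨0, ?_⟩ ⟨ys, hys⟩).trans (hpys x x.2).le
    rintro _ ⟨y, rfl⟩
    exact hge x x.2 y y.2.1
  have hsup : ∀ y : YLE J_Max N_T J_Ave, R ≤ ⨆ x : mixedSet (N_T + 1),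
      payoff P_T N J_Max N_T (x : Fin (N_T + 1) → ℝ) (y : Fin (N_T + 1) → ℝ) := by
    intro y
    refine (hpxs y y.2.1).ge.trans
      (le_ciSup (f := fun x : mixedSet (N_T + 1) => payoff P_T N J_Max N_T x y)
        ⟨∑ i, ∑ j, payC P_T N J_Max N_T i j, ?_⟩ ⟨xs, hxs⟩)
    · rintro _ ⟨x, rfl⟩
      exact hle x x.2 y y.2.1
  refine ⟨le_antisymm (ciSup_le hinf) ?_, le_antisymm ?_ (le_ciInf hsup), ?_⟩
  · refine le_trans ?_ (le_ciSup (f := fun x : mixedSet (N_T + 1) =>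
      ⨅ y : YLE J_Max N_T J_Ave, payoff P_T N J_Max N_T x y) ⟨R, ?_⟩ ⟨xs, hxs⟩)
    · exact le_ciInf fun y => (hpxs y y.2.1).ge
    · rintro _ ⟨x, rfl⟩
      exact hinf x
  · refine (ciInf_le (f := fun y : YLE J_Max N_T J_Ave =>
      ⨆ x : mixedSet (N_T + 1), payoff P_T N J_Max N_T x y) ⟨R, ?_⟩ ⟨ys, hys⟩).trans ?_
    · rintro _ ⟨y, rfl⟩
      exact hsup y
    · exact ciSup_le fun x => (hpys x x.2).le
  · rw [hR, rate, div_self hNpos.ne', one_mul]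
end
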